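/- Let n ≥ 1 and let t_1, …, t_n be positive integers with T := Σ_{i=1}^n t_i². Let k > 0 be a real number satisfying n·k² ≤ T. Then Σ_{i=1}^n ⌈t_i/k⌉² ≤ 4T/k². -/

import Mathlib

/-- Step-grouping estimate for variable time search: if `t_1, …, t_n` are
positive integers with `T = Σ t_i²`, and `k > 0` is a real number with
`n·k² ≤ T`, then `Σ ⌈t_i/k⌉² ≤ 4T/k²`. -/
theorem step_grouping_estimate
    (n : ℕ) (hn : 1 ≤ n) (t : Fin n → ℕ) (ht : ∀ i, 0 < t i)
    (T : ℕ) (hT : T = ∑ i, (t i) ^ 2)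
    (k : ℝ) (hk : 0 < k) (hnk : (n : ℝ) * k ^ 2 ≤ (T : ℝ)) :
    ∑ i, ((⌈(t i : ℝ) / k⌉ : ℝ)) ^ 2 ≤ 4 * (T : ℝ) / k ^ 2 := by
  have ceil_sq_le (i : Fin n) :
      ((⌈(t i : ℝ) / k⌉ : ℝ)) ^ 2 ≤ 2 * ((t i : ℝ) ^ 2 / k ^ 2) + 2 := by
    have hx : 0 ≤ (t i : ℝ) / k := by positivity
    have hnonneg : (0 : ℝ) ≤ ⌈(t i : ℝ) / k⌉ := hx.trans (Int.le_ceil _)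
    have hlt := Int.ceil_lt_add_one ((t i : ℝ) / k)
    rw [← div_pow]
    nlinarith [sq_nonneg ((t i : ℝ) / k - 1)]
  have hn_le : (n : ℝ) ≤ T / k ^ 2 := (le_div_iff₀ (by positivity)).2 hnk
  calc ∑ i, ((⌈(t i : ℝ) / k⌉ : ℝ)) ^ 2
      ≤ ∑ i, (2 * ((t i : ℝ) ^ 2 / k ^ 2) + 2) := Finset.sum_le_sum fun i _ => ceil_sq_le i
    _ = 2 * (T / k ^ 2) + 2 * n := by
      rw [Finset.sum_add_distrib, ← Finset.mul_sum, ← Finset.sum_div, hT]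
      simp [mul_comm]
    _ ≤ 4 * (T : ℝ) / k ^ 2 := by
      rw [mul_div_assoc]
      linarith
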